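/- arXiv:2307.03446 — 2 statements merged into one kernel-verified Lean document; each statement's English description precedes it below -/
import Mathlib

section
/- Let Φ be a CNF formula over Fin d each of whose clauses contains at most one negated literal, i.e. at most one literal of the form (i, false) (a Dual-Horn SAT formula). Then for every D ⊆ Fin d there exists a CNF formula Φ' over the variable set {i : Fin d // i ∉ D}, each of whose clauses contains at most one negated literal, such that disc(Φ') = π_D(disc(Φ)). -/
/-- The discrete solution space of a CNF formula. -/
def cnfDisc {V : Type*} (Φ : Finset (Finset (V × Bool))) : Set (V → Bool) :=
  {x | ∀ C ∈ Φ, ∃ l ∈ C, x l.1 = l.2}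

/-- The projection forgetting the coordinates in `D`. -/
def proj {d : ℕ} (D : Set (Fin d)) (x : Fin d → Bool) : {i : Fin d // i ∉ D} → Bool :=
  fun i => x i.1

/-- A clause has at most one negated literal iff any two of its negated variables agree. -/
theorem card_filter_negated_le_one_iff {V : Type*} (C : Finset (V × Bool)) :
    (C.filter fun l => l.2 = false).card ≤ 1 ↔
      ∀ i j, (i, false) ∈ C → (j, false) ∈ C → i = j := by
  simp only [Finset.card_le_one, Finset.mem_filter]
  constructor
  · intro h i j hi hj
    exact congrArg Prod.fst (h (i, false) ⟨hi, rfl⟩ (j, false) ⟨hj, rfl⟩)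
  · rintro h ⟨i, b⟩ ⟨hi, rfl⟩ ⟨j, c⟩ ⟨hj, rfl⟩
    rw [h i j hi hj]

/-- The solution space of a Dual-Horn formula is closed under pointwise disjunction. -/
theorem supClosed_cnfDisc {V : Type*} {Φ : Finset (Finset (V × Bool))}
    (hΦ : ∀ C ∈ Φ, (C.filter fun l => l.2 = false).card ≤ 1) : SupClosed (cnfDisc Φ) := by
  intro x hx y hy C hC
  obtain ⟨⟨i, b⟩, hi, hxi⟩ := hx C hC
  obtain ⟨⟨j, c⟩, hj, hyj⟩ := hy C hC
  cases b
  · cases c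
    · obtain rfl := (card_filter_negated_le_one_iff C).1 (hΦ C hC) i j hi hj
      exact ⟨(i, false), hi, by simp_all⟩
    · exact ⟨(j, true), hj, by simp_all⟩
  · exact ⟨(i, true), hi, by simp_all⟩

/-- Every set of assignments closed under pointwise disjunction is the solution space of a
Dual-Horn formula, namely the set of all Dual-Horn clauses it satisfies. -/
theorem SupClosed.exists_dualHorn_cnfDisc_eq {V : Type*} [Finite V] {S : Set (V → Bool)}
    (hS : SupClosed S) :
    ∃ Φ : Finset (Finset (V × Bool)),
      (∀ C ∈ Φ, (C.filter fun l => l.2 = false).card ≤ 1) ∧ cnfDisc Φ = S := by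
  classical
  have := Fintype.ofFinite V
  refine ⟨Finset.univ.filter fun C => (C.filter fun l => l.2 = false).card ≤ 1 ∧
    ∀ x ∈ S, ∃ l ∈ C, x l.1 = l.2, fun C hC => (Finset.mem_filter.1 hC).2.1, ?_⟩
  refine Set.Subset.antisymm (fun z hz => ?_) fun x hx C hC => (Finset.mem_filter.1 hC).2.2 x hx
  have hsat (C : Finset (V × Bool)) (hC : ∀ i j, (i, false) ∈ C → (j, false) ∈ C → i = j)
      (hCS : ∀ x ∈ S, ∃ l ∈ C, x l.1 = l.2) : ∃ l ∈ C, z l.1 = l.2 :=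
    hz C (Finset.mem_filter.2
      ⟨Finset.mem_univ _, (card_filter_negated_le_one_iff C).2 hC, hCS⟩)
  have hnle {y : V → Bool} (hy : ¬ y ≤ z) : ∃ j, z j = false ∧ y j = true := by
    simp only [Pi.le_def, not_forall] at hy
    obtain ⟨j, hj⟩ := hy
    exact ⟨j, by revert hj; cases z j <;> cases y j <;> simp⟩
  have hne : {x ∈ S | x ≤ z}.Nonempty := by
    by_contra hempty
    obtain ⟨⟨i, b⟩, hl, hzl⟩ := hsat (Finset.univ.filter fun l => l.2 = true ∧ z l.1 = false)
      (by simp) fun y hy => by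
        obtain ⟨j, hzj, hyj⟩ := hnle fun hyz => hempty ⟨y, hy, hyz⟩
        exact ⟨(j, true), by simp [hzj], hyj⟩
    simp_all
  obtain ⟨x, ⟨hxS, hxz⟩, hmax⟩ := (Set.toFinite {x ∈ S | x ≤ z}).exists_maximal hne
  suffices z ≤ x by rwa [← le_antisymm hxz this]
  intro i
  by_contra hi
  have hzi : z i = true ∧ x i = false := by revert hi; cases z i <;> cases x i <;> simp
  obtain ⟨⟨k, b⟩, hl, hzl⟩ := hsat
    (insert (i, false) (Finset.univ.filter fun l => l.2 = true ∧ z l.1 = false))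
    (by simp) fun y hy => by
      by_cases hyz : y ≤ z
      · have hyx : y ≤ x := le_sup_left.trans
          (hmax ⟨hS hy hxS, sup_le hyz hxz⟩ le_sup_right)
        exact ⟨(i, false), by simp, le_bot_iff.1 ((hyx i).trans_eq hzi.2)⟩
      · obtain ⟨j, hzj, hyj⟩ := hnle hyz
        exact ⟨(j, true), by simp [hzj], hyj⟩
  rcases Finset.mem_insert.1 hl with h | h
  · simp_all
  · simp_all

/-- The image of a set closed under pointwise disjunction under a projection is so too. -/
theorem SupClosed.proj_image {d : ℕ} {S : Set (Fin d → Bool)} (hS : SupClosed S)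
    (D : Set (Fin d)) : SupClosed (proj D '' S) := by
  rintro _ ⟨x, hx, rfl⟩ _ ⟨y, hy, rfl⟩
  exact ⟨x ⊔ y, hS hx hy, rfl⟩

/-- Projections of solution spaces of this SAT fragment are again solution spaces of
formulas of the same fragment. -/
theorem dualHornSat_projection_closed
    (d : ℕ) (Φ : Finset (Finset (Fin d × Bool)))
    (hΦ : ∀ C ∈ Φ, (C.filter fun l => l.2 = false).card ≤ 1) (D : Set (Fin d)) :
    ∃ Φ' : Finset (Finset ({i : Fin d // i ∉ D} × Bool)),
      (∀ C' ∈ Φ', (C'.filter fun l => l.2 = false).card ≤ 1) ∧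
      cnfDisc Φ' = proj D '' cnfDisc Φ := by
  exact ((supClosed_cnfDisc hΦ).proj_image D).exists_dualHorn_cnfDisc_eq
end

section
/- For every CNF formula Ψ over Fin d each of whose clauses contains at most 3 literals, there exists a CNF formula Φ over a variable set Fin d ⊕ Fin k, each of whose clauses contains at most 3 literals, among them at most 2 positive literals (literals of the form (i, true)) and at most 2 negated literals (literals of the form (i, false)), such that the induced cubical complex N(disc(Φ)) is homotopy equivalent to N(disc(Ψ)). -/
/-- The induced cubical complex of a set `X` of Boolean vertices of the unit cube. -/
def inducedCubicalComplex {V : Type*} (X : Set (V → Bool)) : Set (V → ℝ) :=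
  {p | (∀ i, 0 ≤ p i ∧ p i ≤ 1) ∧
    ∀ v : V → Bool, (∀ i, (p i = 0 → v i = false) ∧ (p i = 1 → v i = true)) → v ∈ X}

/-- The degree in `[0, 1]` to which a coordinate `t` agrees with the Boolean value `b`. -/
noncomputable def literalValue (b : Bool) (t : ℝ) : ℝ := if b then t else 1 - t

/-- The piecewise linear self-map of `[0, 1]` collapsing `[0, 1/4]` to `0` and `[3/4, 1]` to `1`. -/
noncomputable def sharpen (t : ℝ) : ℝ := max 0 (min 1 (2 * t - 1 / 2))

/-- A Boolean vector is a vertex of the open face of the unit cube containing `p`. -/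
def IsFaceVertex {V : Type*} (p : V → ℝ) (v : V → Bool) : Prop :=
  ∀ i, (p i = 0 → v i = false) ∧ (p i = 1 → v i = true)

lemma literalValue_continuous (b : Bool) : Continuous (literalValue b) := by
  unfold literalValue; cases b <;> simp <;> fun_prop

lemma sharpen_continuous : Continuous sharpen := by
  unfold sharpen; fun_prop

lemma literalValue_literalValue (b : Bool) (t : ℝ) : literalValue b (literalValue b t) = t := by
  cases b <;> simp [literalValue]

lemma literalValue_mem (b : Bool) {t : ℝ} (ht : 0 ≤ t ∧ t ≤ 1) :
    0 ≤ literalValue b t ∧ literalValue b t ≤ 1 := by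
  cases b <;> simp [literalValue] <;> grind

lemma literalValue_not_eq_one (b : Bool) (t : ℝ) :
    literalValue (!b) t = 1 ↔ literalValue b t = 0 := by
  cases b <;> simp [literalValue]; grind

lemma literalValue_convex (b : Bool) (r s t : ℝ) :
    literalValue b ((1 - r) * s + r * t) =
      (1 - r) * literalValue b s + r * literalValue b t := by
  cases b <;> simp [literalValue]; ring

lemma sharpen_mem (t : ℝ) : 0 ≤ sharpen t ∧ sharpen t ≤ 1 := by
  unfold sharpen; grind

lemma sharpen_zero : sharpen 0 = 0 := by norm_num [sharpen]

lemma sharpen_one : sharpen 1 = 1 := by norm_num [sharpen]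

lemma sharpen_eq_zero {t : ℝ} (ht : t ≤ 1 / 4) : sharpen t = 0 := by
  unfold sharpen; grind

lemma sharpen_eq_one {t : ℝ} (ht : 3 / 4 ≤ t) : sharpen t = 1 := by
  unfold sharpen; grind

lemma literalValue_sharpen (b : Bool) (t : ℝ) :
    literalValue b (sharpen t) = sharpen (literalValue b t) := by
  cases b <;> simp [literalValue, sharpen]; grind

/-- A cubical complex contains the closed face carrying each of its points. -/
lemma inducedCubicalComplex_of_face {V : Type*} {X : Set (V → Bool)} {p q : V → ℝ}
    (hp : p ∈ inducedCubicalComplex X) (hq : ∀ i, 0 ≤ q i ∧ q i ≤ 1)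
    (h : ∀ i, (p i = 0 → q i = 0) ∧ (p i = 1 → q i = 1)) : q ∈ inducedCubicalComplex X :=
  ⟨hq, fun v hv => hp.2 v fun i => ⟨fun h0 => (hv i).1 ((h i).1 h0),
    fun h1 => (hv i).2 ((h i).2 h1)⟩⟩

lemma sharpen_mem_inducedCubicalComplex {V : Type*} {X : Set (V → Bool)} {p : V → ℝ}
    (hp : p ∈ inducedCubicalComplex X) : (fun i => sharpen (p i)) ∈ inducedCubicalComplex X :=
  inducedCubicalComplex_of_face hp (fun _ => sharpen_mem _) fun i =>
    ⟨fun h => by simp [h, sharpen_zero], fun h => by simp [h, sharpen_one]⟩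

lemma segment_sharpen_mem_inducedCubicalComplex {V : Type*} {X : Set (V → Bool)} {p : V → ℝ}
    (hp : p ∈ inducedCubicalComplex X) {r : ℝ} (hr : 0 ≤ r ∧ r ≤ 1) :
    (fun i => (1 - r) * p i + r * sharpen (p i)) ∈ inducedCubicalComplex X := by
  refine inducedCubicalComplex_of_face hp (fun i => ?_) fun i =>
    ⟨fun h => by simp [h, sharpen_zero], fun h => by simp [h, sharpen_one]⟩
  obtain ⟨h0, h1⟩ := hp.1 i
  obtain ⟨h2, h3⟩ := sharpen_mem (p i)
  obtain ⟨h4, h5⟩ := hr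
  constructor <;> nlinarith

/-- A non-tautological clause holds on the whole face of `p` iff some literal of it is
constantly true there. -/
lemma forall_isFaceVertex_iff {V : Type*} {C : Finset (V × Bool)} {p : V → ℝ}
    (hC : ∀ i, (i, true) ∈ C → (i, false) ∉ C) :
    (∀ v, IsFaceVertex p v → ∃ l ∈ C, v l.1 = l.2) ↔ ∃ l ∈ C, literalValue l.2 (p l.1) = 1 := by
  classical
  constructor
  · intro h
    obtain ⟨⟨i, b⟩, hl, hv⟩ := h
      (fun i => if p i = 0 then false else if p i = 1 then true else decide ((i, true) ∉ C))
      (fun i => ⟨fun h => by simp [h], fun h => by simp [h]⟩)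
    refine ⟨_, hl, ?_⟩
    have := hC i
    simp only [literalValue] at *
    cases b <;> grind
  · rintro ⟨⟨i, b⟩, hl, hv⟩ v hp
    refine ⟨_, hl, ?_⟩
    have := hp i
    cases b <;> simp [literalValue] at * <;> grind

lemma mem_inducedCubicalComplex_cnfDisc {V : Type*} {Φ : Finset (Finset (V × Bool))}
    {p : V → ℝ} :
    p ∈ inducedCubicalComplex (cnfDisc Φ) ↔ (∀ i, 0 ≤ p i ∧ p i ≤ 1) ∧
      ∀ C ∈ Φ, ∀ v, IsFaceVertex p v → ∃ l ∈ C, v l.1 = l.2 :=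
  and_congr_right fun _ => ⟨fun h C hC v hv => h v hv C hC, fun h v hv C hC => h C hC v hv⟩

/-- Two maps into a set of real vectors joined by segments inside the set are homotopic. -/
lemma homotopic_of_segment {Y W : Type*} [TopologicalSpace Y] {S : Set (W → ℝ)}
    (f g : C(Y, S))
    (h : ∀ y (r : ℝ), 0 ≤ r ∧ r ≤ 1 →
      (fun i => (1 - r) * (f y).1 i + r * (g y).1 i) ∈ S) :
    f.Homotopic g :=
  ⟨{ toFun := fun ry => ⟨_, h ry.2 ry.1 ry.1.2⟩
     continuous_toFun := by
       refine Continuous.subtype_mk (continuous_pi fun i => ?_) _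
       have hf : Continuous fun ry : unitInterval × Y => (f ry.2).1 i :=
         (continuous_apply i).comp (continuous_subtype_val.comp (f.continuous.comp continuous_snd))
       have hg : Continuous fun ry : unitInterval × Y => (g ry.2).1 i :=
         (continuous_apply i).comp (continuous_subtype_val.comp (g.continuous.comp continuous_snd))
       have hr : Continuous fun ry : unitInterval × Y => (ry.1 : ℝ) :=
         continuous_subtype_val.comp continuous_fst
       exact ((continuous_const.sub hr).mul hf).add (hr.mul hg)
     map_zero_left := fun y => by simp
     map_one_left := fun y => by simp }⟩

/-- The truth degree of an auxiliary literal splitting the clause `a ∨ b ∨ c`, given the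
truth degrees of the three literals. -/
noncomputable def splitDegree (a b c : ℝ) : ℝ := sharpen (1 / 2 + (max a b - c))

lemma splitDegree_spec {a b c : ℝ} (ha : a ≤ 1) (hb : b ≤ 1)
    (h : a = 1 ∨ b = 1 ∨ c = 1) :
    (splitDegree a b c = 1 ∨ sharpen c = 1) ∧
      (splitDegree a b c = 0 ∨ sharpen a = 1 ∨ sharpen b = 1) := by
  constructor
  · by_cases h' : 3 / 4 ≤ c
    · exact .inr (sharpen_eq_one h')
    · exact .inl (sharpen_eq_one (by grind))
  · by_cases h1 : 3 / 4 ≤ a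
    · exact .inr (.inl (sharpen_eq_one h1))
    by_cases h2 : 3 / 4 ≤ b
    · exact .inr (.inr (sharpen_eq_one h2))
    exact .inl (sharpen_eq_zero (by grind))

/-- Splitting clauses `a ∨ b ∨ c` of literals of sign `β` into `y ∨ c` and `a ∨ b ∨ ¬y` does
not change the homotopy type of the induced cubical complex. -/
theorem homotopyEquiv_of_split {V K : Type*} {X : Set (V → Bool)} {Z : Set (V ⊕ K → Bool)}
    (β : K → Bool) (a b c : K → V)
    (hX : ∀ p ∈ inducedCubicalComplex X, ∀ j, literalValue (β j) (p (a j)) = 1 ∨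
      literalValue (β j) (p (b j)) = 1 ∨ literalValue (β j) (p (c j)) = 1)
    (hZ : ∀ z, z ∈ inducedCubicalComplex Z ↔ (fun i => z (.inl i)) ∈ inducedCubicalComplex X ∧
      ∀ j, (0 ≤ z (.inr j) ∧ z (.inr j) ≤ 1) ∧
        (literalValue (β j) (z (.inr j)) = 1 ∨ literalValue (β j) (z (.inl (c j))) = 1) ∧
        (literalValue (β j) (z (.inr j)) = 0 ∨ literalValue (β j) (z (.inl (a j))) = 1 ∨
          literalValue (β j) (z (.inl (b j))) = 1)) :
    Nonempty (ContinuousMap.HomotopyEquiv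
      (inducedCubicalComplex Z) (inducedCubicalComplex X)) := by
  let y (p : V → ℝ) (j : K) : ℝ := literalValue (β j) (splitDegree
    (literalValue (β j) (p (a j))) (literalValue (β j) (p (b j))) (literalValue (β j) (p (c j))))
  let s (p : V → ℝ) : V ⊕ K → ℝ := Sum.elim (fun i => sharpen (p i)) (y p)
  have hs : ∀ p ∈ inducedCubicalComplex X, s p ∈ inducedCubicalComplex Z := by
    intro p hp
    refine (hZ _).2 ⟨sharpen_mem_inducedCubicalComplex hp, fun j => ?_⟩
    refine ⟨literalValue_mem _ (sharpen_mem _), ?_⟩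
    simp only [s, y, Sum.elim_inl, Sum.elim_inr, literalValue_literalValue, literalValue_sharpen]
    exact splitDegree_spec (literalValue_mem _ (hp.1 _)).2 (literalValue_mem _ (hp.1 _)).2 (hX p hp j)
  have hsc : Continuous s := by
    refine continuous_pi fun i => ?_
    have := sharpen_continuous
    rcases i with i | j
    · simp only [s, Sum.elim_inl]; fun_prop
    · have := literalValue_continuous (β j)
      simp only [s, y, Sum.elim_inr, splitDegree]; fun_prop
  let π : C(inducedCubicalComplex Z, inducedCubicalComplex X) :=
    ⟨fun z => ⟨fun i => z.1 (.inl i), ((hZ _).1 z.2).1⟩, by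
      refine Continuous.subtype_mk (continuous_pi fun i => ?_) _
      exact (continuous_apply (Sum.inl i)).comp continuous_subtype_val⟩
  let σ : C(inducedCubicalComplex X, inducedCubicalComplex Z) :=
    ⟨fun p => ⟨s p.1, hs _ p.2⟩, (hsc.comp continuous_subtype_val).subtype_mk _⟩
  let τ : C(inducedCubicalComplex Z, inducedCubicalComplex Z) :=
    ⟨fun z => ⟨fun i => sharpen (z.1 i), sharpen_mem_inducedCubicalComplex z.2⟩, by
      refine Continuous.subtype_mk (continuous_pi fun i => ?_) _
      exact sharpen_continuous.comp ((continuous_apply i).comp continuous_subtype_val)⟩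
  have hτ : (ContinuousMap.id _).Homotopic τ := homotopic_of_segment _ _ fun z _ hr =>
    segment_sharpen_mem_inducedCubicalComplex z.2 hr
  have hστ : τ.Homotopic (σ.comp π) := by
    refine homotopic_of_segment _ _ fun z r hr => ?_
    have h1 := (hZ _).1 (τ z).2
    have h2 := (hZ _).1 (σ (π z)).2
    have hl : ∀ i, (1 - r) * (τ z).1 (.inl i) + r * (σ (π z)).1 (.inl i) = (τ z).1 (.inl i) := by
      intro i
      change (1 - r) * sharpen (z.1 (.inl i)) + r * sharpen (z.1 (.inl i)) = sharpen (z.1 (.inl i))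
      ring
    have hl' : ∀ i, (σ (π z)).1 (.inl i) = (τ z).1 (.inl i) := fun i => rfl
    refine (hZ _).2 ⟨?_, fun j => ?_⟩
    · simp only [ContinuousMap.comp_apply, hl]
      exact h1.1
    · obtain ⟨⟨u0, u1⟩, h3, h4⟩ := h1.2 j
      obtain ⟨⟨w0, w1⟩, h5, h6⟩ := h2.2 j
      simp only [ContinuousMap.comp_apply, hl, literalValue_convex]
      rw [hl'] at h5
      rw [hl', hl'] at h6
      obtain ⟨r0, r1⟩ := hr
      refine ⟨⟨by nlinarith, by nlinarith⟩, ?_, ?_⟩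
      · rcases h3 with h3 | h3
        · rcases h5 with h5 | h5
          · left; rw [h3, h5]; ring
          · exact .inr h5
        · exact .inr h3
      · rcases h4 with h4 | h4
        · rcases h6 with h6 | h6
          · left; rw [h4, h6]; ring
          · exact .inr h6
        · exact .inr h4
  exact ⟨⟨π, σ, (hτ.trans hστ).symm, (homotopic_of_segment _ _ fun p _ hr =>
    segment_sharpen_mem_inducedCubicalComplex p.2 hr).symm⟩⟩

/-- A clause is a monochromatic triple if it consists of three literals of the same sign. -/
def IsMonochromaticTriple {V : Type*} [DecidableEq V] (C : Finset (V × Bool)) : Prop :=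
  ∃ (β : Bool) (a b c : V), C = {(a, β), (b, β), (c, β)}

lemma card_filter_le_two {V : Type*} [DecidableEq V] {C : Finset (V × Bool)} (hC : C.card ≤ 3)
    (h : ¬ IsMonochromaticTriple C) (β : Bool) : (C.filter fun l => l.2 = β).card ≤ 2 := by
  by_contra! hlt
  have heq := Finset.eq_of_subset_of_card_le (Finset.filter_subset (fun l => l.2 = β) C)
    (by omega)
  have hmono : ∀ l ∈ C, l.2 = β := Finset.filter_eq_self.1 heq
  rw [heq] at hlt
  obtain ⟨⟨a, b₁⟩, ⟨b, b₂⟩, ⟨c, b₃⟩, -, -, -, rfl⟩ := Finset.card_eq_three.1 (by omega : C.card = 3)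
  simp at hmono
  obtain ⟨rfl, rfl, rfl⟩ := hmono
  exact h ⟨_, a, b, c, rfl⟩

lemma exists_enumeration_monochromaticTriple {V : Type*} [DecidableEq V]
    (Ψ : Finset (Finset (V × Bool))) :
    ∃ (k : ℕ) (β : Fin k → Bool) (a b c : Fin k → V),
      (∀ j, {(a j, β j), (b j, β j), (c j, β j)} ∈ Ψ) ∧
      ∀ C ∈ Ψ, IsMonochromaticTriple C → ∃ j, C = {(a j, β j), (b j, β j), (c j, β j)} := by
  classical
  let e := (Ψ.filter IsMonochromaticTriple).equivFin
  have h : ∀ j, IsMonochromaticTriple (e.symm j).1 := fun j =>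
    (Finset.mem_filter.1 (e.symm j).2).2
  choose β a b c habc using h
  refine ⟨_, β, a, b, c, fun j => ?_, fun C hC hm => ?_⟩
  · rw [← habc]
    exact (Finset.mem_filter.1 (e.symm j).2).1
  · refine ⟨e ⟨C, Finset.mem_filter.2 ⟨hC, hm⟩⟩, ?_⟩
    rw [← habc, Equiv.symm_apply_apply]

/-- A clause regarded as a clause over an extended variable set. -/
def liftClause {V : Type*} (K : Type*) (C : Finset (V × Bool)) : Finset ((V ⊕ K) × Bool) :=
  C.map (Function.Embedding.inl.prodMap (Function.Embedding.refl Bool))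

lemma card_filter_liftClause {V : Type*} (K : Type*) (C : Finset (V × Bool)) (β : Bool) :
    ((liftClause K C).filter fun l => l.2 = β).card = (C.filter fun l => l.2 = β).card := by
  rw [liftClause, Finset.filter_map, Finset.card_map]
  rfl

lemma forall_isFaceVertex_liftClause {V K : Type*} {C : Finset (V × Bool)} {z : V ⊕ K → ℝ} :
    (∀ v, IsFaceVertex z v → ∃ l ∈ liftClause K C, v l.1 = l.2) ↔
      ∀ v, IsFaceVertex (fun i => z (.inl i)) v → ∃ l ∈ C, v l.1 = l.2 := by
  classical
  simp only [liftClause, Finset.mem_map, exists_exists_and_eq_and]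
  constructor
  · intro h v hv
    refine h (Sum.elim v fun j => decide (z (.inr j) = 1)) fun i => ?_
    rcases i with i | j
    · exact hv i
    · constructor <;> intro h <;> simp [h]
  · intro h v hv
    exact h (fun i => v (.inl i)) fun i => hv (.inl i)

/-- Every 3-CNF formula `Ψ` can be translated into a (3,2,2)-CNF formula `Φ`
(at most 3 literals, at most 2 positive and at most 2 negated literals per clause,
over extra auxiliary variables) whose induced cubical complex is homotopy equivalent
to that of `Ψ`. -/
theorem threeCnf_to_322Cnf_homotopyEquiv
    (d : ℕ) (Ψ : Finset (Finset (Fin d × Bool)))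
    (hΨ : ∀ C ∈ Ψ, C.card ≤ 3) :
    ∃ (k : ℕ) (Φ : Finset (Finset ((Fin d ⊕ Fin k) × Bool))),
      (∀ C ∈ Φ, C.card ≤ 3 ∧ (C.filter fun l => l.2 = true).card ≤ 2 ∧
        (C.filter fun l => l.2 = false).card ≤ 2) ∧
      Nonempty (ContinuousMap.HomotopyEquiv
        (inducedCubicalComplex (cnfDisc Φ)) (inducedCubicalComplex (cnfDisc Ψ))) := by
  classical
  obtain ⟨k, β, a, b, c, hmem, hmono⟩ := exists_enumeration_monochromaticTriple Ψ
  let P (j : Fin k) : Finset ((Fin d ⊕ Fin k) × Bool) := {(.inr j, β j), (.inl (c j), β j)}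
  let Q (j : Fin k) : Finset ((Fin d ⊕ Fin k) × Bool) :=
    {(.inl (a j), β j), (.inl (b j), β j), (.inr j, !β j)}
  let G := Ψ.filter fun C => ¬ IsMonochromaticTriple C
  have hP : ∀ (z : Fin d ⊕ Fin k → ℝ) j,
      (∀ v, IsFaceVertex z v → ∃ l ∈ P j, v l.1 = l.2) ↔
        literalValue (β j) (z (.inr j)) = 1 ∨ literalValue (β j) (z (.inl (c j))) = 1 := by
    intro z j
    rw [forall_isFaceVertex_iff (by simp only [P]; grind)]
    simp [P]
  have hQ : ∀ (z : Fin d ⊕ Fin k → ℝ) j,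
      (∀ v, IsFaceVertex z v → ∃ l ∈ Q j, v l.1 = l.2) ↔
        literalValue (β j) (z (.inr j)) = 0 ∨ literalValue (β j) (z (.inl (a j))) = 1 ∨
          literalValue (β j) (z (.inl (b j))) = 1 := by
    intro z j
    rw [forall_isFaceVertex_iff (by simp only [Q]; grind)]
    simp only [Q, Finset.mem_insert, Finset.mem_singleton, exists_eq_or_imp, exists_eq_left,
      literalValue_not_eq_one]
    tauto
  have hT : ∀ (p : Fin d → ℝ) j,
      (∀ v, IsFaceVertex p v →
        ∃ l ∈ ({(a j, β j), (b j, β j), (c j, β j)} : Finset _), v l.1 = l.2) ↔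
        literalValue (β j) (p (a j)) = 1 ∨ literalValue (β j) (p (b j)) = 1 ∨
          literalValue (β j) (p (c j)) = 1 := by
    intro p j
    rw [forall_isFaceVertex_iff (by grind)]
    simp
  refine ⟨k, G.image (liftClause (Fin k)) ∪ (Finset.univ.image P ∪ Finset.univ.image Q), ?_, ?_⟩
  · intro C hC
    simp only [Finset.mem_union, Finset.mem_image, Finset.mem_univ, true_and] at hC
    rcases hC with ⟨C, hC, rfl⟩ | ⟨j, rfl⟩ | ⟨j, rfl⟩
    · obtain ⟨hC, hm⟩ := Finset.mem_filter.1 hC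
      rw [card_filter_liftClause, card_filter_liftClause, liftClause, Finset.card_map]
      exact ⟨hΨ C hC, card_filter_le_two (hΨ C hC) hm _, card_filter_le_two (hΨ C hC) hm _⟩
    · have h2 : (P j).card ≤ 2 := Finset.card_le_two
      exact ⟨by omega, (Finset.card_filter_le _ _).trans h2, (Finset.card_filter_le _ _).trans h2⟩
    · refine ⟨Finset.card_le_three, ?_⟩
      cases h : β j <;>
        simp [Q, h, Finset.filter_insert, Finset.filter_singleton, Finset.card_le_two]
  · refine homotopyEquiv_of_split β a b c (fun p hp j =>
      (hT p j).1 ((mem_inducedCubicalComplex_cnfDisc.1 hp).2 _ (hmem j))) fun z => ?_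
    simp only [mem_inducedCubicalComplex_cnfDisc, Finset.forall_mem_union,
      Finset.forall_mem_image, Finset.mem_univ, true_imp_iff, forall_isFaceVertex_liftClause,
      hP, hQ, Sum.forall, forall_and]
    constructor
    · rintro ⟨⟨⟨hl0, hr0⟩, hl1, hr1⟩, hG, hp, hq⟩
      refine ⟨⟨⟨hl0, hl1⟩, fun C hC => ?_⟩, ⟨hr0, hr1⟩, hp, hq⟩
      by_cases hm : IsMonochromaticTriple C
      · obtain ⟨j, rfl⟩ := hmono C hC hm
        refine (hT _ j).2 ?_
        have := @hp j
        have := @hq j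
        grind
      · exact hG (Finset.mem_filter.2 ⟨hC, hm⟩)
    · rintro ⟨⟨⟨hl0, hl1⟩, hG⟩, ⟨hr0, hr1⟩, hp, hq⟩
      exact ⟨⟨⟨hl0, hr0⟩, hl1, hr1⟩, fun C hC => hG C (Finset.mem_filter.1 hC).1, hp, hq⟩
end
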